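/- arXiv:2006.10127 — 4 statements merged into one kernel-verified Lean document; each statement's English description precedes it below -/
import Mathlib

section
/- Let $\mathfrak{h}$ be a Lie algebra over a field $K$ of characteristic zero equipped with a post-Lie product $\triangleright$. Then the bilinear operation $\llbracket x,y\rrbracket := x\triangleright y - y\triangleright x + [x,y]$ is a Lie bracket on the underlying vector space of $\mathfrak{h}$; that is, it is alternating and satisfies the Jacobi identity. -/
/-- If `(𝔥, ▷)` is a post-Lie algebra over a field of characteristic zero,
then `⟦x,y⟧ := x ▷ y - y ▷ x + ⁅x,y⁆` is a Lie bracket: alternating and Jacobi. -/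
theorem postLie_bracket_isLie (K : Type*) [Field K] [CharZero K]
    (L : Type*) [LieRing L] [LieAlgebra K L]
    (t : L →ₗ[K] L →ₗ[K] L)
    (PL1 : ∀ x y z : L, t x ⁅y, z⁆ = ⁅t x y, z⁆ + ⁅y, t x z⁆)
    (PL2 : ∀ x y z : L, t ⁅x, y⁆ z =
      (t x (t y z) - t (t x y) z) - (t y (t x z) - t (t y x) z))
    (br : L → L → L)
    (hbr : ∀ x y : L, br x y = t x y - t y x + ⁅x, y⁆) :
    (∀ x : L, br x x = 0) ∧
    (∀ x y z : L, br x (br y z) + br y (br z x) + br z (br x y) = 0) := by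
  refine ⟨fun x => by simp [hbr], fun x y z => ?_⟩
  have s : ∀ a b c : L, ⁅t a b, c⁆ = -⁅c, t a b⁆ := fun a b c => (lie_skew _ _).symm
  have j := lie_jacobi x y z
  simp only [hbr, map_add, map_sub, LinearMap.add_apply, LinearMap.sub_apply, lie_add, lie_sub,
    PL1, PL2, s]
  rw [← sub_eq_zero] at j
  rw [← j]
  abel
end

section
/- Let $\mathfrak{g}$ and $\mathfrak{h}$ be Lie algebras over a field $K$ of characteristic zero, $\upsilon:\mathfrak{g}\to\mathrm{Der}(\mathfrak{h})$ a morphism of Lie algebras, and $\phi:\mathfrak{g}\to\mathfrak{h}$ a bijective linear map which is a crossed morphism relative to $\upsilon$. Then the bilinear operation on $\mathfrak{h}$ defined by $\llbracket a,b\rrbracket := \upsilon_{\phi^{-1}(a)}(b) - \upsilon_{\phi^{-1}(b)}(a) + [a,b]_{\mathfrak{h}}$ is a Lie bracket, and $\phi$ is an isomorphism of Lie algebras from $\mathfrak{g}$ to $(\mathfrak{h},\llbracket-,-\rrbracket)$. -/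
/-- If `φ : 𝔤 ≃ 𝔥` is a bijective crossed morphism relative to a Lie morphism
`υ : 𝔤 → Der(𝔥)`, then `⟦a,b⟧ := υ (φ⁻¹ a) b - υ (φ⁻¹ b) a + ⁅a,b⁆` is a Lie bracket on 𝔥
and `φ` is an isomorphism of Lie algebras from 𝔤 onto `(𝔥, ⟦-,-⟧)`. -/
theorem crossed_iso_transports_bracket (K : Type*) [Field K] [CharZero K]
    (g h : Type*) [LieRing g] [LieAlgebra K g] [LieRing h] [LieAlgebra K h]
    (υ : g →ₗ⁅K⁆ LieDerivation K h h)
    (φ : g ≃ₗ[K] h)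
    (hcross : ∀ x y : g, φ ⁅x, y⁆ = υ x (φ y) - υ y (φ x) + ⁅φ x, φ y⁆)
    (br : h → h → h)
    (hbr : ∀ a b : h, br a b = υ (φ.symm a) b - υ (φ.symm b) a + ⁅a, b⁆) :
    (∀ a : h, br a a = 0) ∧
    (∀ a b c : h, br a (br b c) + br b (br c a) + br c (br a b) = 0) ∧
    (∀ x y : g, φ ⁅x, y⁆ = br (φ x) (φ y)) := by
  have key : ∀ x y : g, φ ⁅x, y⁆ = br (φ x) (φ y) := by
    intro x y
    rw [hbr, hcross, φ.symm_apply_apply, φ.symm_apply_apply]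
  refine ⟨fun a => by simp [hbr], fun a b c => ?_, key⟩
  obtain ⟨x, rfl⟩ := φ.surjective a
  obtain ⟨y, rfl⟩ := φ.surjective b
  obtain ⟨z, rfl⟩ := φ.surjective c
  simp only [← key, ← map_add]
  rw [lie_jacobi, map_zero]
end

section
/- Let $\mathfrak{g}$ be a Lie algebra over a field $K$ of characteristic zero, $V$ a vector space regarded as an abelian Lie algebra, $\upsilon:\mathfrak{g}\to\mathrm{End}_K(V)$ a morphism of Lie algebras (i.e. $\upsilon_{[x,y]}=\upsilon_x\circ\upsilon_y-\upsilon_y\circ\upsilon_x$), and $\phi:\mathfrak{g}\to V$ a bijective linear map satisfying $\phi([x,y])=\upsilon_x(\phi(y))-\upsilon_y(\phi(x))$ for all $x,y\in\mathfrak{g}$ (a bijective 1-cocycle). Then the product $a\triangleright b:=\upsilon_{\phi^{-1}(a)}(b)$ on $V$ is left pre-Lie, i.e. its associator is symmetric in the first two arguments: $a\triangleright(b\triangleright c)-(a\triangleright b)\triangleright c = b\triangleright(a\triangleright c)-(b\triangleright a)\triangleright c$ for all $a,b,c\in V$. -/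
/-- A bijective 1-cocycle `φ : 𝔤 → V` relative to a representation
`υ : 𝔤 → End V` yields a left pre-Lie product `a ▷ b := υ (φ⁻¹ a) b` on `V`. -/
theorem bijective_cocycle_gives_preLie (K : Type*) [Field K] [CharZero K]
    (g : Type*) [LieRing g] [LieAlgebra K g]
    (V : Type*) [AddCommGroup V] [Module K V]
    (υ : g →ₗ[K] Module.End K V)
    (hυ : ∀ x y : g, υ ⁅x, y⁆ = υ x * υ y - υ y * υ x)
    (φ : g ≃ₗ[K] V)
    (hcocycle : ∀ x y : g, φ ⁅x, y⁆ = υ x (φ y) - υ y (φ x)) :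
    ∀ a b c : V,
      υ (φ.symm a) (υ (φ.symm b) c) - υ (φ.symm (υ (φ.symm a) b)) c =
        υ (φ.symm b) (υ (φ.symm a) c) - υ (φ.symm (υ (φ.symm b) a)) c := by
  intro a b c
  have h1 : ⁅φ.symm a, φ.symm b⁆
      = φ.symm (υ (φ.symm a) b) - φ.symm (υ (φ.symm b) a) := by
    apply φ.injective
    rw [hcocycle]
    simp
  have h2 := congrArg (fun f : Module.End K V => f c) (hυ (φ.symm a) (φ.symm b))
  simp only [h1, map_sub, LinearMap.sub_apply, Module.End.mul_apply] at h2
  rw [sub_eq_sub_iff_sub_eq_sub]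
  exact h2.symm
end

section
/- Let $\mathfrak{g},\mathfrak{h}$ be Lie algebras over a field $K$ of characteristic zero, $\upsilon:\mathfrak{g}\to\mathrm{Der}(\mathfrak{h})$ a Lie algebra morphism, and $\phi:\mathfrak{g}\to\mathfrak{h}$ a crossed morphism relative to $\upsilon$. Let $\iota:\mathfrak{h}\to\mathcal{U}(\mathfrak{h})$ be the canonical map into the universal enveloping algebra and let $\rho:\mathfrak{g}\to\mathrm{Der}_K(\mathcal{U}(\mathfrak{h}))$ be a linear map such that each $\rho_x$ is a $K$-linear derivation of the associative algebra $\mathcal{U}(\mathfrak{h})$ satisfying $\rho_x(\iota(a))=\iota(\upsilon_x(a))$ for all $a\in\mathfrak{h}$. Define $M:\mathfrak{g}\to\mathrm{End}_K(\mathcal{U}(\mathfrak{h}))$ by $M(x)=\rho_x+L_{\iota(\phi(x))}$, where $L_u$ denotes left multiplication by $u$. Then $M([x,y]_{\mathfrak{g}})=M(x)\circ M(y)-M(y)\circ M(x)$ for all $x,y\in\mathfrak{g}$; in particular $\mathcal{U}(\mathfrak{h})$ is a $\mathfrak{g}$-module via $M$. -/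
theorem uea_mem_of_ι_mem {K h : Type*} [Field K] [LieRing h] [LieAlgebra K h]
    (S : Subalgebra K (UniversalEnvelopingAlgebra K h))
    (hS : ∀ a : h, UniversalEnvelopingAlgebra.ι K a ∈ S)
    (u : UniversalEnvelopingAlgebra K h) : u ∈ S := by
  let : LieRing S := LieRing.ofAssociativeRing
  let : LieRing (UniversalEnvelopingAlgebra K h) := LieRing.ofAssociativeRing
  let f : h →ₗ⁅K⁆ S :=
    { toFun := fun a => ⟨UniversalEnvelopingAlgebra.ι K a, hS a⟩
      map_add' := fun a b => Subtype.ext (by simp)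
      map_smul' := fun c a => Subtype.ext (by simp)
      map_lie' := fun {a b} => Subtype.ext (by
        simp [LieRing.of_associative_ring_bracket]) }
  have key : S.val.comp (UniversalEnvelopingAlgebra.lift K f) = AlgHom.id K _ := by
    apply UniversalEnvelopingAlgebra.hom_ext
    refine LieHom.ext fun a => ?_
    change S.val (UniversalEnvelopingAlgebra.lift K f (UniversalEnvelopingAlgebra.ι K a)) = _
    rw [UniversalEnvelopingAlgebra.lift_ι_apply]
    rfl
  have h2 := DFunLike.congr_fun key u
  change ((UniversalEnvelopingAlgebra.lift K f u : S) : UniversalEnvelopingAlgebra K h) = u at h2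
  rw [← h2]
  exact Subtype.property _

theorem uea_derivation_eq_zero {K h : Type*} [Field K] [LieRing h] [LieAlgebra K h]
    (D : Module.End K (UniversalEnvelopingAlgebra K h))
    (hD : ∀ u v, D (u * v) = D u * v + u * D v)
    (hι : ∀ a : h, D (UniversalEnvelopingAlgebra.ι K a) = 0)
    (u : UniversalEnvelopingAlgebra K h) : D u = 0 := by
  have h1 : D 1 = 0 := by
    have := hD 1 1
    simpa using this
  let S : Subalgebra K (UniversalEnvelopingAlgebra K h) :=
    { carrier := {u | D u = 0}
      mul_mem' := fun {a b} ha hb => by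
        simp only [Set.mem_ofPred_eq] at *
        rw [hD, ha, hb]; simp
      add_mem' := fun {a b} ha hb => by
        simp only [Set.mem_ofPred_eq] at *
        rw [map_add, ha, hb, add_zero]
      algebraMap_mem' := fun c => by
        simp only [Set.mem_ofPred_eq]
        rw [Algebra.algebraMap_eq_smul_one, map_smul, h1, smul_zero] }
  exact uea_mem_of_ι_mem S hι u

/-- Given a crossed morphism `φ : 𝔤 → 𝔥` relative to a Lie morphism
`υ : 𝔤 → Der(𝔥)`, with `ρ` the extension of `υ` to derivations of `𝒰(𝔥)`, the map
`M x = ρ x + L_{ι(φ x)}` satisfies `M ⁅x,y⁆ = M x ∘ M y - M y ∘ M x`, i.e. `𝒰(𝔥)`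
is a `𝔤`-module via `M`. -/
theorem crossed_morphism_module_structure (K : Type*) [Field K] [CharZero K]
    (g h : Type*) [LieRing g] [LieAlgebra K g] [LieRing h] [LieAlgebra K h]
    (υ : g →ₗ⁅K⁆ LieDerivation K h h)
    (φ : g →ₗ[K] h)
    (hcross : ∀ x y : g, φ ⁅x, y⁆ = υ x (φ y) - υ y (φ x) + ⁅φ x, φ y⁆)
    (ρ : g →ₗ[K] Module.End K (UniversalEnvelopingAlgebra K h))
    (hleib : ∀ (x : g) (u v : UniversalEnvelopingAlgebra K h),
      ρ x (u * v) = ρ x u * v + u * ρ x v)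
    (hρι : ∀ (x : g) (a : h),
      ρ x (UniversalEnvelopingAlgebra.ι K a) = UniversalEnvelopingAlgebra.ι K (υ x a))
    (M : g → Module.End K (UniversalEnvelopingAlgebra K h))
    (hM : ∀ x : g, M x = ρ x +
      (LinearMap.mulLeft K (UniversalEnvelopingAlgebra.ι K (φ x)) :
        Module.End K (UniversalEnvelopingAlgebra K h))) :
    ∀ x y : g, M ⁅x, y⁆ = M x * M y - M y * M x := by
  intro x y
  have hρ : ∀ u, ρ ⁅x, y⁆ u = ρ x (ρ y u) - ρ y (ρ x u) := by
    intro u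
    have := uea_derivation_eq_zero (ρ ⁅x, y⁆ - (ρ x * ρ y - ρ y * ρ x)) ?_ ?_ u
    · simpa [sub_eq_zero] using this
    · intro u v
      simp only [LinearMap.sub_apply, Module.End.mul_apply, hleib, map_add]
      noncomm_ring
    · intro a
      simp only [LinearMap.sub_apply, Module.End.mul_apply, hρι, LieHom.map_lie,
        LieDerivation.lie_apply, map_sub, sub_self]
  ext u
  simp only [hM, LinearMap.sub_apply, Module.End.mul_apply, LinearMap.add_apply,
    LinearMap.mulLeft_apply, hρ, hcross, map_add, map_sub, hleib, hρι, LieHom.map_lie,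
    LieRing.of_associative_ring_bracket]
  noncomm_ring
end
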